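/- Let R(q) = (q,q^4;q^5)_∞/(q^2,q^3;q^5)_∞ and E(q)=(q;q)_∞. Then 1/(R(q) R(q^2)^2) - q^2 R(q) R(q^2)^2 = E(q^2) E(q^5)^5/(E(q) E(q^{10})^5). -/

import Mathlib

/-- Euler's product E(q) = ∏_{k≥0} (1 - q^{k+1}). -/
noncomputable def E (q : ℂ) : ℂ := ∏' k : ℕ, (1 - q ^ (k + 1))

/-- q-Pochhammer infinite product (a;q)_∞ = ∏_{k≥0} (1 - a q^k). -/
noncomputable def qp (a q : ℂ) : ℂ := ∏' k : ℕ, (1 - a * q ^ k)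

/-- Rogers–Ramanujan function G(q) = 1/((q,q^4;q^5)_∞). -/
noncomputable def G (q : ℂ) : ℂ := 1 / (qp q (q ^ 5) * qp (q ^ 4) (q ^ 5))

/-- Rogers–Ramanujan function H(q) = 1/((q^2,q^3;q^5)_∞). -/
noncomputable def H (q : ℂ) : ℂ := 1 / (qp (q ^ 2) (q ^ 5) * qp (q ^ 3) (q ^ 5))

/-- Rogers–Ramanujan continued fraction product R(q). -/
noncomputable def R (q : ℂ) : ℂ :=
  (qp q (q ^ 5) * qp (q ^ 4) (q ^ 5)) / (qp (q ^ 2) (q ^ 5) * qp (q ^ 3) (q ^ 5))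

open Filter Topology Finset

/-- The triangular number `n(n-1)/2` of an integer. -/
def tri (n : ℤ) : ℤ := n * (n - 1) / 2

lemma two_mul_tri (n : ℤ) : 2 * tri n = n * (n - 1) :=
  Int.mul_ediv_cancel' (Int.even_mul_pred_self n).two_dvd

lemma tri_add_one (n : ℤ) : tri (n + 1) = tri n + n := by
  linarith [two_mul_tri n, two_mul_tri (n + 1)]

/-- General term of the theta series `∑ p^{n(n-1)/2} x^n`. -/
noncomputable def thetaTerm (p x : ℂ) (n : ℤ) : ℂ := p ^ tri n * x ^ n

/-- The theta series `∑_{n ∈ ℤ} p^{n(n-1)/2} x^n`. -/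
noncomputable def thetaSeries (p x : ℂ) : ℂ := ∑' n : ℤ, thetaTerm p x n

lemma thetaTerm_ne_zero {p x : ℂ} (hp : p ≠ 0) (hx : x ≠ 0) (n : ℤ) : thetaTerm p x n ≠ 0 :=
  mul_ne_zero (zpow_ne_zero _ hp) (zpow_ne_zero _ hx)

lemma thetaTerm_add_one {p x : ℂ} (hp : p ≠ 0) (hx : x ≠ 0) (n : ℤ) :
    thetaTerm p x (n + 1) = thetaTerm p x n * (p ^ n * x) := by
  simp only [thetaTerm, tri_add_one, zpow_add₀ hp, zpow_add₀ hx, zpow_one]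
  ring

lemma summable_norm_thetaTerm {p x : ℂ} (hp0 : p ≠ 0) (hp : ‖p‖ < 1) (hx : x ≠ 0) :
    Summable fun n ↦ ‖thetaTerm p x n‖ := by
  have hpow := tendsto_pow_atTop_nhds_zero_of_lt_one (norm_nonneg p) hp
  have hne (n : ℤ) : ‖thetaTerm p x n‖ ≠ 0 := norm_ne_zero_iff.2 (thetaTerm_ne_zero hp0 hx n)
  refine Summable.of_nat_of_neg ?_ ?_
  · refine summable_of_ratio_test_tendsto_lt_one (l := 0) one_pos (.of_forall fun n ↦ hne n) ?_
    have := hpow.mul_const ‖x‖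
    rw [zero_mul] at this
    refine this.congr fun n ↦ ?_
    have h := thetaTerm_add_one hp0 hx (n : ℤ)
    push_cast
    rw [h, norm_norm, norm_norm, eq_div_iff (hne n)]
    simp only [norm_mul, zpow_natCast, norm_pow]
    ring
  · refine summable_of_ratio_test_tendsto_lt_one (l := 0) one_pos (.of_forall fun n ↦ hne _) ?_
    have := (hpow.comp (tendsto_add_atTop_nat 1)).mul_const ‖x‖⁻¹
    rw [zero_mul] at this
    refine this.congr fun n ↦ ?_
    have h := thetaTerm_add_one hp0 hx (-((n + 1 : ℕ) : ℤ))
    rw [show -((n + 1 : ℕ) : ℤ) + 1 = -(n : ℤ) by push_cast; ring, zpow_neg, zpow_natCast] at h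
    rw [norm_norm, norm_norm, eq_div_iff (hne _), h]
    have hp1 : ‖p‖ ≠ 0 := norm_ne_zero_iff.2 hp0
    have hx1 : ‖x‖ ≠ 0 := norm_ne_zero_iff.2 hx
    simp only [norm_mul, norm_inv, norm_pow, Function.comp]
    field_simp

lemma hasSum_thetaSeries {p x : ℂ} (hp0 : p ≠ 0) (hp : ‖p‖ < 1) (hx : x ≠ 0) :
    HasSum (thetaTerm p x) (thetaSeries p x) :=
  (summable_norm_thetaTerm hp0 hp hx).of_norm.hasSum

/-- A product of two theta series splits, according to the parity of the sum of the summation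
indices, into a bilinear expression in theta series of nome `p ^ 2`. -/
lemma thetaSeries_mul {p x y : ℂ} (hp0 : p ≠ 0) (hp : ‖p‖ < 1) (hx : x ≠ 0) (hy : y ≠ 0) :
    thetaSeries p x * thetaSeries p y =
      thetaSeries (p ^ 2) (x * y) * thetaSeries (p ^ 2) (p * (x / y)) +
        y * (thetaSeries (p ^ 2) (p * (x * y)) * thetaSeries (p ^ 2) (x / y)) := by
  have hp2 : p ^ 2 ≠ 0 := pow_ne_zero 2 hp0
  have hp2' : ‖p ^ 2‖ < 1 := by
    rw [norm_pow]; exact pow_lt_one₀ (norm_nonneg _) hp two_ne_zero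
  have hprod {r u v : ℂ} (hr0 : r ≠ 0) (hr : ‖r‖ < 1) (hu : u ≠ 0) (hv : v ≠ 0) :
      HasSum (fun z : ℤ × ℤ ↦ thetaTerm r u z.1 * thetaTerm r v z.2)
        (thetaSeries r u * thetaSeries r v) := by
    have h1 := summable_norm_thetaTerm hr0 hr hu
    have h2 := summable_norm_thetaTerm hr0 hr hv
    rw [thetaSeries, thetaSeries, tsum_mul_tsum_of_summable_norm h1 h2]
    exact (summable_mul_of_summable_norm h1 h2).hasSum
  let e : ℤ × ℤ → ℤ × ℤ := fun z ↦ (z.1 + z.2, z.1 - z.2)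
  let o : ℤ × ℤ → ℤ × ℤ := fun z ↦ (z.1 + z.2, z.1 - z.2 + 1)
  have he : Function.Injective e := by
    rintro ⟨a, b⟩ ⟨c, d⟩ h
    simp only [e, Prod.mk.injEq] at h ⊢
    omega
  have ho : Function.Injective o := by
    rintro ⟨a, b⟩ ⟨c, d⟩ h
    simp only [o, Prod.mk.injEq] at h ⊢
    omega
  have hcompl : IsCompl (Set.range e) (Set.range o) := by
    refine ⟨Set.disjoint_left.2 ?_, codisjoint_iff.2 (Set.eq_univ_of_forall ?_)⟩
    · rintro _ ⟨⟨a, b⟩, rfl⟩ ⟨⟨c, d⟩, h⟩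
      simp only [e, o, Prod.mk.injEq] at h
      omega
    · rintro ⟨m, n⟩
      rcases Int.even_or_odd' (m + n) with ⟨c, hc | hc⟩
      · exact .inl ⟨(c, m - c), by simp only [e, Prod.mk.injEq]; omega⟩
      · exact .inr ⟨(c, m - c), by simp only [o, Prod.mk.injEq]; omega⟩
  set f : ℤ × ℤ → ℂ := fun z ↦ thetaTerm p x z.1 * thetaTerm p y z.2 with hf
  have hsum {u v : ℂ} (hu : HasSum (f ∘ e) u) (hv : HasSum (f ∘ o) v) : HasSum f (u + v) :=
    HasSum.add_isCompl hcompl (he.hasSum_range_iff.2 hu) (ho.hasSum_range_iff.2 hv)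
  refine (hprod hp0 hp hx hy).unique (hsum ?_ ?_)
  · refine HasSum.congr_fun
      (hprod hp2 hp2' (mul_ne_zero hx hy) (mul_ne_zero hp0 (div_ne_zero hx hy))) fun ⟨a, b⟩ ↦ ?_
    simp only [hf, e, thetaTerm, Function.comp]
    have h : tri (a + b) + tri (a - b) = 2 * tri a + 2 * tri b + b := by
      linarith [two_mul_tri a, two_mul_tri b, two_mul_tri (a + b), two_mul_tri (a - b)]
    calc p ^ tri (a + b) * x ^ (a + b) * (p ^ tri (a - b) * y ^ (a - b))
        = p ^ (tri (a + b) + tri (a - b)) * (x ^ (a + b) * y ^ (a - b)) := by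
          rw [zpow_add₀ hp0]; ring
      _ = _ := by
          rw [h, zpow_add₀ hp0, zpow_add₀ hp0, zpow_add₀ hx, zpow_sub₀ hy, zpow_mul, zpow_mul,
            mul_zpow, mul_zpow, div_zpow, zpow_ofNat]
          ring
  · refine HasSum.congr_fun
      ((hprod hp2 hp2' (mul_ne_zero hp0 (mul_ne_zero hx hy)) (div_ne_zero hx hy)).mul_left y)
      fun ⟨a, b⟩ ↦ ?_
    simp only [hf, o, thetaTerm, Function.comp]
    have h : tri (a + b) + tri (a - b + 1) = 2 * tri a + 2 * tri b + a := by
      linarith [two_mul_tri a, two_mul_tri b, two_mul_tri (a + b), two_mul_tri (a - b + 1)]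
    calc p ^ tri (a + b) * x ^ (a + b) * (p ^ tri (a - b + 1) * y ^ (a - b + 1))
        = p ^ (tri (a + b) + tri (a - b + 1)) * (x ^ (a + b) * y ^ (a - b + 1)) := by
          rw [zpow_add₀ hp0]; ring
      _ = _ := by
          rw [h, zpow_add₀ hp0, zpow_add₀ hp0, zpow_add₀ hx, zpow_add₀ hy, zpow_sub₀ hy, zpow_mul,
            zpow_mul, mul_zpow, mul_zpow, div_zpow, zpow_ofNat, zpow_one]
          ring

/-- The finite product `∏_{i<k} (1 - p^{i+1})`. -/
noncomputable def finEuler (p : ℂ) (k : ℕ) : ℂ := ∏ i ∈ range k, (1 - p ^ (i + 1))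

/-- The reciprocal of `finEuler`, extended by zero to negative integers. -/
noncomputable def finEulerInv (p : ℂ) (k : ℤ) : ℂ := if k < 0 then 0 else (finEuler p k.toNat)⁻¹

lemma one_sub_pow_ne_zero {p : ℂ} (hp : ‖p‖ < 1) (n : ℕ) : 1 - p ^ (n + 1) ≠ 0 := by
  intro h
  have h1 : ‖p ^ (n + 1)‖ < 1 := by
    rw [norm_pow]; exact pow_lt_one₀ (norm_nonneg _) hp n.succ_ne_zero
  rw [← sub_eq_zero.1 h, norm_one] at h1
  exact lt_irrefl _ h1

lemma finEulerInv_sub_one {p : ℂ} (hp : ‖p‖ < 1) (k : ℤ) :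
    finEulerInv p (k - 1) = (1 - p ^ k) * finEulerInv p k := by
  rcases lt_trichotomy k 0 with h | rfl | h
  · simp [finEulerInv, h, show k - 1 < 0 by omega]
  · simp [finEulerInv]
  · obtain ⟨n, rfl⟩ : ∃ n : ℕ, k = n + 1 := ⟨(k - 1).toNat, by omega⟩
    have h2 : ((n : ℤ) + 1).toNat = n + 1 := by omega
    have h3 := one_sub_pow_ne_zero hp n
    have h4 : p ^ ((n : ℤ) + 1) = p ^ (n + 1) := by exact_mod_cast zpow_natCast p (n + 1)
    rw [finEulerInv, finEulerInv, if_neg (by omega), if_neg (by omega), h2, h4, finEuler, finEuler,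
      prod_range_succ, mul_inv, add_sub_cancel_right, Int.toNat_natCast]
    field_simp

/-- Coefficients in the finite form of the Jacobi triple product. -/
noncomputable def tripleCoeff (p : ℂ) (n : ℕ) (j : ℤ) : ℂ :=
  finEuler p (2 * n) * (finEulerInv p (n - j) * finEulerInv p (n + j))

lemma tripleCoeff_add_one {p : ℂ} (hp0 : p ≠ 0) (hp : ‖p‖ < 1) (n : ℕ) (j : ℤ) :
    tripleCoeff p (n + 1) j = (1 + p ^ (2 * n + 1)) * tripleCoeff p n j
      + p ^ ((n : ℤ) + 1 - j) * tripleCoeff p n (j - 1)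
      + p ^ ((n : ℤ) + 1 + j) * tripleCoeff p n (j + 1) := by
  have hM := finEulerInv_sub_one hp ((n : ℤ) + 1 - j)
  have hM' := finEulerInv_sub_one hp ((n : ℤ) + 1 - j - 1)
  have hN := finEulerInv_sub_one hp ((n : ℤ) + 1 + j)
  have hN' := finEulerInv_sub_one hp ((n : ℤ) + 1 + j - 1)
  have hXY : p ^ ((n : ℤ) + 1 - j) * p ^ ((n : ℤ) + 1 + j) = p ^ (2 * n + 2) := by
    rw [← zpow_add₀ hp0, ← zpow_natCast]; congr 1; push_cast; ring
  have e1 : (n : ℤ) - j = n + 1 - j - 1 := by ring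
  have e2 : (n : ℤ) + j = n + 1 + j - 1 := by ring
  have e3 : (n : ℤ) - (j - 1) = n + 1 - j := by ring
  have e4 : (n : ℤ) + (j - 1) = n + 1 + j - 1 - 1 := by ring
  have e5 : (n : ℤ) - (j + 1) = n + 1 - j - 1 - 1 := by ring
  have e6 : (n : ℤ) + (j + 1) = n + 1 + j := by ring
  have hE : finEuler p (2 * (n + 1)) =
      finEuler p (2 * n) * (1 - p ^ (2 * n + 1)) * (1 - p ^ (2 * n + 2)) := by
    simp [finEuler, mul_add, prod_range_succ]
  simp only [tripleCoeff, hE]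
  push_cast
  rw [e1, e2, e3, e4, e5, e6, hM', hN', hM, hN, zpow_sub_one₀ hp0, zpow_sub_one₀ hp0, ← hXY]
  have hs : p ^ (2 * n + 1) = p ^ ((n : ℤ) + 1 - j) * p ^ ((n : ℤ) + 1 + j) * p⁻¹ := by
    rw [hXY, pow_succ p (2 * n + 1), mul_inv_cancel_right₀ hp0]
  rw [hs]
  ring

/-- The finite form of the Jacobi triple product. -/
lemma hasSum_finite_triple_product {p x : ℂ} (hp0 : p ≠ 0) (hp : ‖p‖ < 1) (hx : x ≠ 0) (n : ℕ) :
    HasSum (fun j ↦ tripleCoeff p n j * thetaTerm p (-x) j)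
      (∏ k ∈ range n, ((1 - x * p ^ k) * (1 - p / x * p ^ k))) := by
  have hx' : -x ≠ 0 := neg_ne_zero.2 hx
  induction n with
  | zero =>
    convert hasSum_single (0 : ℤ) ?_
    · simp [tripleCoeff, thetaTerm, finEuler, finEulerInv, tri]
    · intro j hj
      rcases hj.lt_or_gt with h | h <;> simp [tripleCoeff, finEulerInv, h]
  | succ n ih =>
    have h1 := ih.mul_left (1 + p ^ (2 * n + 1))
    have h2 := ((Equiv.subRight (1 : ℤ)).hasSum_iff.2 ih).mul_left (-(p ^ n * x))
    have h3 := ((Equiv.addRight (1 : ℤ)).hasSum_iff.2 ih).mul_left (-(p ^ (n + 1) / x))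
    have h := (h1.add h2).add h3
    have hprod (S : ℂ) : S * ((1 - x * p ^ n) * (1 - p / x * p ^ n)) =
        (1 + p ^ (2 * n + 1)) * S + -(p ^ n * x) * S + -(p ^ (n + 1) / x) * S := by
      field_simp
      ring
    rw [prod_range_succ, hprod]
    refine h.congr_fun fun j ↦ ?_
    have t1 := thetaTerm_add_one hp0 hx' (j - 1)
    have t2 := thetaTerm_add_one hp0 hx' j
    rw [sub_add_cancel] at t1
    have hj := zpow_ne_zero j hp0
    simp only [Function.comp, Equiv.subRight_apply, Equiv.coe_addRight,
      tripleCoeff_add_one hp0 hp, t2]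
    simp only [t1, zpow_sub₀ hp0, zpow_add₀ hp0, zpow_natCast, zpow_one]
    field_simp
    ring

lemma norm_mul_pow_lt_one {a p : ℂ} (ha : ‖a‖ < 1) (hp : ‖p‖ < 1) (k : ℕ) : ‖a * p ^ k‖ < 1 := by
  rw [norm_mul, norm_pow]
  exact (mul_le_of_le_one_right (norm_nonneg _) (pow_le_one₀ (norm_nonneg _) hp.le)).trans_lt ha

lemma summable_norm_neg_mul_pow (a : ℂ) {p : ℂ} (hp : ‖p‖ < 1) :
    Summable fun k : ℕ ↦ ‖-(a * p ^ k)‖ := by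
  simpa using (summable_geometric_of_lt_one (norm_nonneg _) hp).mul_left ‖a‖

lemma tendsto_qp (a : ℂ) {p : ℂ} (hp : ‖p‖ < 1) :
    Tendsto (fun n ↦ ∏ k ∈ range n, (1 - a * p ^ k)) atTop (𝓝 (qp a p)) := by
  have h := multipliable_one_add_of_summable (summable_norm_neg_mul_pow a hp)
  simpa only [qp, ← sub_eq_add_neg] using h.hasProd.tendsto_prod_nat

lemma qp_ne_zero {a p : ℂ} (ha : ‖a‖ < 1) (hp : ‖p‖ < 1) : qp a p ≠ 0 := by
  have h := tprod_one_add_ne_zero_of_summable (f := fun k : ℕ ↦ -(a * p ^ k)) (fun k h ↦ ?_)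
    (summable_norm_neg_mul_pow a hp)
  · simpa only [qp, ← sub_eq_add_neg] using h
  · have h1 := norm_mul_pow_lt_one ha hp k
    rw [← sub_eq_zero.1 ((sub_eq_add_neg _ _).trans h), norm_one] at h1
    exact lt_irrefl _ h1

lemma E_eq_qp (q : ℂ) : E q = qp q q := by
  simp only [E, qp, pow_succ']

lemma tendsto_finEuler {p : ℂ} (hp : ‖p‖ < 1) : Tendsto (finEuler p) atTop (𝓝 (qp p p)) := by
  refine (tendsto_qp p hp).congr fun n ↦ ?_
  simp only [finEuler, pow_succ']

lemma tendsto_finEulerInv {p : ℂ} (hp : ‖p‖ < 1) :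
    Tendsto (finEulerInv p) atTop (𝓝 (qp p p)⁻¹) := by
  have h := ((tendsto_finEuler hp).inv₀ (qp_ne_zero hp hp)).comp
    ((tendsto_natCast_atTop_iff (R := ℤ)).1 (tendsto_atTop_mono Int.self_le_toNat tendsto_id))
  refine h.congr' ?_
  filter_upwards [eventually_ge_atTop 0] with k hk
  simp [finEulerInv, not_lt.2 hk]

lemma tendsto_tripleCoeff {p : ℂ} (hp : ‖p‖ < 1) (j : ℤ) :
    Tendsto (fun n ↦ tripleCoeff p n j) atTop (𝓝 (qp p p)⁻¹) := by
  have hc : Tendsto (fun n : ℕ ↦ (n : ℤ)) atTop atTop := tendsto_natCast_atTop_atTop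
  have h0 := (tendsto_finEuler hp).comp (tendsto_id.const_mul_atTop' two_pos)
  have h1 := (tendsto_finEulerInv hp).comp (tendsto_atTop_add_const_right _ (-j) hc)
  have h2 := (tendsto_finEulerInv hp).comp (tendsto_atTop_add_const_right _ j hc)
  have h := h0.mul (h1.mul h2)
  rw [mul_inv_cancel_left₀ (qp_ne_zero hp hp)] at h
  exact h

lemma exists_norm_tripleCoeff_le {p : ℂ} (hp : ‖p‖ < 1) :
    ∃ C, ∀ n j, ‖tripleCoeff p n j‖ ≤ C := by
  obtain ⟨B, hB⟩ := (tendsto_finEuler hp).norm.bddAbove_range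
  obtain ⟨D, hD⟩ := ((tendsto_finEuler hp).inv₀ (qp_ne_zero hp hp)).norm.bddAbove_range
  have hB' (n : ℕ) : ‖finEuler p n‖ ≤ B := hB ⟨n, rfl⟩
  have hD0 : 0 ≤ D := (norm_nonneg _).trans (hD ⟨0, rfl⟩)
  have hD' (k : ℤ) : ‖finEulerInv p k‖ ≤ D := by
    rw [finEulerInv]
    split_ifs
    · simpa using hD0
    · exact hD ⟨k.toNat, rfl⟩
  refine ⟨B * (D * D), fun n j ↦ ?_⟩
  rw [tripleCoeff, norm_mul, norm_mul]
  have hB0 : 0 ≤ B := (norm_nonneg _).trans (hB' 0)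
  gcongr
  exacts [hB' _, hD' _, hD' _]

/-- The Jacobi triple product identity. -/
theorem jacobi_triple_product {p x : ℂ} (hp0 : p ≠ 0) (hp : ‖p‖ < 1) (hx : x ≠ 0) :
    thetaSeries p (-x) = qp p p * (qp x p * qp (p / x) p) := by
  have hx' : -x ≠ 0 := neg_ne_zero.2 hx
  obtain ⟨C, hC⟩ := exists_norm_tripleCoeff_le hp
  have h1 := tendsto_tsum_of_dominated_convergence (𝓕 := atTop)
    ((summable_norm_thetaTerm hp0 hp hx').mul_left C)
    (fun j ↦ (tendsto_tripleCoeff hp j).mul_const (thetaTerm p (-x) j))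
    (.of_forall fun n j ↦ by
      rw [norm_mul]
      exact mul_le_mul_of_nonneg_right (hC n j) (norm_nonneg _))
  have h2 := (tendsto_qp x hp).mul (tendsto_qp (p / x) hp)
  simp only [← prod_mul_distrib, ← (hasSum_finite_triple_product hp0 hp hx _).tsum_eq] at h2
  have h := tendsto_nhds_unique h1 h2
  rw [tsum_mul_left] at h
  rw [← h, mul_inv_cancel_left₀ (qp_ne_zero hp hp), thetaSeries]

/-- Splitting `(a;p)_∞` according to residue classes modulo `m`. -/
lemma qp_eq_prod_residues (a : ℂ) {p : ℂ} (hp : ‖p‖ < 1) {m : ℕ} (hm : m ≠ 0) :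
    qp a p = ∏ i ∈ range m, qp (a * p ^ i) (p ^ m) := by
  have hpm : ‖p ^ m‖ < 1 := by
    rw [norm_pow]; exact pow_lt_one₀ (norm_nonneg _) hp hm
  have h1 := (tendsto_qp a hp).comp (tendsto_id.const_mul_atTop' (Nat.pos_of_ne_zero hm))
  have h2 := tendsto_finsetProd (range m) fun i _ ↦ tendsto_qp (a * p ^ i) hpm
  refine tendsto_nhds_unique h1 (h2.congr fun n ↦ ?_)
  simp only [Function.comp, id]
  induction n with
  | zero => simp
  | succ n ih =>
    simp only [mul_add, mul_one, prod_range_add, prod_range_succ _ n, prod_mul_distrib, ih]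
    congr 1
    refine prod_congr rfl fun i _ ↦ ?_
    ring

/-- The instance of the three-term theta relation behind the identity, with `s i` standing for
`(q^i;q^{10})_∞`. -/
lemma theta_three_term {q : ℂ} (hq0 : q ≠ 0) (hq : ‖q‖ < 1) :
    let s : ℕ → ℂ := fun i ↦ qp (q ^ i) (q ^ 10)
    (s 3 * s 7) ^ 2 * (s 4 * s 6) ^ 2 - q ^ 2 * ((s 1 * s 9) ^ 2 * (s 2 * s 8) ^ 2)
      = (s 2 * s 8) * (s 4 * s 6) * (s 5 * s 5) ^ 2 := by
  intro s
  have hp0 : q ^ 10 ≠ 0 := pow_ne_zero _ hq0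
  have hp : ‖q ^ 10‖ < 1 := by
    rw [norm_pow]; exact pow_lt_one₀ (norm_nonneg _) hq (by norm_num)
  have hs : s 10 ≠ 0 := qp_ne_zero hp hp
  set P : ℕ → ℂ := fun k ↦ thetaSeries ((q ^ 10) ^ 2) (q ^ k)
  set Q : ℕ → ℂ := fun k ↦ thetaSeries ((q ^ 10) ^ 2) (q ^ 10 * q ^ k)
  have key (i j k l : ℕ) (hi : i ≤ 10) (hj : j ≤ 10) (hk : i + j = k) (hl : i = l + j) :
      s 10 ^ 2 * (s i * s (10 - i)) * (s j * s (10 - j)) = P k * Q l - q ^ j * (Q k * P l) := by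
    have jtp {m : ℕ} (hm : m ≤ 10) :
        thetaSeries (q ^ 10) (-q ^ m) = s 10 * (s m * s (10 - m)) := by
      rw [jacobi_triple_product hp0 hp (pow_ne_zero m hq0), div_eq_mul_inv, ← pow_sub₀ q hq0 hm]
    have h := thetaSeries_mul hp0 hp (neg_ne_zero.2 (pow_ne_zero i hq0))
      (neg_ne_zero.2 (pow_ne_zero j hq0))
    rw [neg_mul_neg, neg_div_neg_eq, ← pow_add, hk, jtp hi, jtp hj, hl, pow_add,
      mul_div_cancel_right₀ _ (pow_ne_zero j hq0), ← hl] at h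
    linear_combination h
  have h55 := key 5 5 10 0 (by norm_num) (by norm_num) rfl rfl
  have h33 := key 3 3 6 0 (by norm_num) (by norm_num) rfl rfl
  have h11 := key 1 1 2 0 (by norm_num) (by norm_num) rfl rfl
  have h42 := key 4 2 6 2 (by norm_num) (by norm_num) rfl rfl
  have h82 := key 8 2 10 6 (by norm_num) (by norm_num) rfl rfl
  have h64 := key 6 4 10 2 (by norm_num) (by norm_num) rfl rfl
  norm_num only at h55 h33 h11 h42 h82 h64
  refine mul_left_cancel₀ (pow_ne_zero 4 hs) ?_
  have e1 := congrArg₂ (· * ·) h64 h33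
  have e2 := congrArg₂ (· * ·) h82 h11
  have e3 := congrArg₂ (· * ·) h55 h42
  linear_combination e1 - q ^ 2 * e2 - e3

theorem stmt_5 : ∀ q : ℂ, ‖q‖ < 1 →
    1 / (R q * R (q ^ 2) ^ 2) - q ^ 2 * R q * R (q ^ 2) ^ 2
      = E (q ^ 2) * E (q ^ 5) ^ 5 / (E q * E (q ^ 10) ^ 5) := by
  intro q hq
  rcases eq_or_ne q 0 with rfl | hq0
  · simp [R, E, qp]
  have hpow {m : ℕ} (hm : m ≠ 0) : ‖q ^ m‖ < 1 := by
    rw [norm_pow]; exact pow_lt_one₀ (norm_nonneg _) hq hm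
  have h3 := theta_three_term hq0 hq
  have hs {i : ℕ} (hi : i ≠ 0) : qp (q ^ i) (q ^ 10) ≠ 0 :=
    qp_ne_zero (hpow hi) (hpow (by norm_num))
  set s : ℕ → ℂ := fun i ↦ qp (q ^ i) (q ^ 10) with hsdef
  have hs' {i : ℕ} (hi : i ≠ 0) : s i ≠ 0 := hs hi
  have split (a b m : ℕ) (hb : b ≠ 0) (hm : m ≠ 0) (hbm : b * m = 10) :
      qp (q ^ a) (q ^ b) = ∏ i ∈ range m, s (a + b * i) := by
    rw [qp_eq_prod_residues _ (hpow hb) hm]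
    simp only [hsdef, ← pow_mul, ← pow_add, hbm]
  have q1 := split 1 5 2 (by norm_num) (by norm_num) rfl
  have q4 := split 4 5 2 (by norm_num) (by norm_num) rfl
  have q2 := split 2 5 2 (by norm_num) (by norm_num) rfl
  have q3 := split 3 5 2 (by norm_num) (by norm_num) rfl
  have e1 := split 1 1 10 (by norm_num) (by norm_num) rfl
  have e2 := split 2 2 5 (by norm_num) (by norm_num) rfl
  have e5 := split 5 5 2 (by norm_num) (by norm_num) rfl
  simp only [prod_range_succ, prod_range_zero, one_mul, pow_one] at q1 q4 q2 q3 e1 e2 e5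
  norm_num only at q1 q4 q2 q3 e1 e2 e5
  have hR1 : R q = (s 1 * s 6 * (s 4 * s 9)) / (s 2 * s 7 * (s 3 * s 8)) := by
    rw [R, q1, q4, q2, q3]
  have hR2 : R (q ^ 2) = (s 2 * s 8) / (s 4 * s 6) := by
    simp only [R, ← pow_mul, hsdef, Nat.reduceMul]
  have hE : E (q ^ 10) = s 10 := E_eq_qp _
  rw [hR1, hR2, E_eq_qp q, E_eq_qp (q ^ 2), E_eq_qp (q ^ 5), hE, e1, e2, e5]
  have n1 := hs' (i := 1) (by norm_num)
  have n2 := hs' (i := 2) (by norm_num)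
  have n3 := hs' (i := 3) (by norm_num)
  have n4 := hs' (i := 4) (by norm_num)
  have n5 := hs' (i := 5) (by norm_num)
  have n6 := hs' (i := 6) (by norm_num)
  have n7 := hs' (i := 7) (by norm_num)
  have n8 := hs' (i := 8) (by norm_num)
  have n9 := hs' (i := 9) (by norm_num)
  have n10 := hs' (i := 10) (by norm_num)
  clear_value s
  field_simp
  linear_combination h3
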